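/- arXiv:1905.12895 — 3 statements merged into one kernel-verified Lean document; each statement's English description precedes it below -/
import Mathlib

section
/- The matrix Ā obtained from the Wasserstein-barycenter constraint matrix A by deleting the rows with indices M+1, M+m+1, ..., M+(N−1)m+1 (i.e. the first row of each block G_t) has full row rank; that is, rank(Ā) = M + N(m−1) + 1. -/
open Matrix

/-- Column index type of the Wasserstein-barycenter LP constraint matrix:
a column `Sum.inl ⟨t, (r, j)⟩` corresponds to the entry `Π⁽ᵗ⁾_{r,j}` of the `t`-th
transport plan `Π⁽ᵗ⁾ ∈ ℝ^{m × m_t}`, and a column `Sum.inr r` corresponds to the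
entry `w_r` of the weight vector `w ∈ ℝ^m`. -/
abbrev WB.ColIx (N m : ℕ) (mt : Fin N → ℕ) :=
  (Σ t : Fin N, Fin m × Fin (mt t)) ⊕ Fin m

/-- Row index type of `A`: first the `M = Σ_t m_t` rows of the blocks
`F_t = I_{m_t} ⊗ 1_mᵀ` (constraints `(Π⁽ᵗ⁾)ᵀ 1_m = a⁽ᵗ⁾`), then the `N·m` rows of the
blocks `G_t = 1_{m_t}ᵀ ⊗ I_m` (constraints `Π⁽ᵗ⁾ 1_{m_t} - w = 0`), then one row
for `1_mᵀ w = 1`. -/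
abbrev WB.RowIx (N m : ℕ) (mt : Fin N → ℕ) :=
  (Σ t : Fin N, Fin (mt t)) ⊕ ((Fin N × Fin m) ⊕ Fin 1)

/-- Row index type of `Ā`: the first row (row index `0` in `Fin m`) of each block `G_t`
has been deleted, i.e. rows `M+1, M+m+1, …, M+(N-1)m+1` of `A`. -/
abbrev WB.RowIxBar (N m : ℕ) (mt : Fin N → ℕ) :=
  (Σ t : Fin N, Fin (mt t)) ⊕ ((Fin N × Fin (m - 1)) ⊕ Fin 1)

/-- The Wasserstein-barycenter LP constraint matrix
`A = [[blockdiag(F_1,…,F_N), 0], [blockdiag(G_1,…,G_N), -1_N ⊗ I_m], [0, 1_mᵀ]]`. -/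
def WB.A (N m : ℕ) (mt : Fin N → ℕ) : Matrix (WB.RowIx N m mt) (WB.ColIx N m mt) ℝ :=
  fun row col =>
    match row, col with
    -- rows of F_t = I_{m_t} ⊗ 1_mᵀ : coefficient of Π⁽ᵗ'⁾_{r,j'} in ∑_r Π⁽ᵗ⁾_{r,j}
    | Sum.inl ⟨t, j⟩, Sum.inl ⟨t', (_, j')⟩ =>
        if t = t' ∧ (j : ℕ) = (j' : ℕ) then 1 else 0
    | Sum.inl _, Sum.inr _ => 0
    -- rows of G_t = 1_{m_t}ᵀ ⊗ I_m : coefficient of Π⁽ᵗ'⁾_{r,j'} in ∑_j Π⁽ᵗ⁾_{i,j}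
    | Sum.inr (Sum.inl (t, i)), Sum.inl ⟨t', (r, _)⟩ =>
        if t = t' ∧ r = i then 1 else 0
    -- the block -1_N ⊗ I_m
    | Sum.inr (Sum.inl (_, i)), Sum.inr r => if r = i then -1 else 0
    -- the last row [0, 1_mᵀ]
    | Sum.inr (Sum.inr _), Sum.inl _ => 0
    | Sum.inr (Sum.inr _), Sum.inr _ => 1

/-- The embedding of the rows of `Ā` into the rows of `A`: within each block `G_t`,
row `i ∈ Fin (m-1)` of `Ā` is row `i+1 ∈ Fin m` of `A` (row `0` was deleted). -/
def WB.rowEmbed (N m : ℕ) (mt : Fin N → ℕ) : WB.RowIxBar N m mt → WB.RowIx N m mt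
  | Sum.inl s => Sum.inl s
  | Sum.inr (Sum.inl (t, i)) =>
      Sum.inr (Sum.inl (t, ⟨i.val + 1, by have := i.isLt; omega⟩))
  | Sum.inr (Sum.inr o) => Sum.inr (Sum.inr o)

/-- `Ā`, obtained from `A` by deleting the first row of each block `G_t`. -/
def WB.Abar (N m : ℕ) (mt : Fin N → ℕ) : Matrix (WB.RowIxBar N m mt) (WB.ColIx N m mt) ℝ :=
  (WB.A N m mt).submatrix (WB.rowEmbed N m mt) id

/-- The action of a row vector on a column of `Ā` indexed by an entry of `Π⁽ᵗ⁾`. -/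
lemma WB.vecMul_Abar_inl (N m : ℕ) (mt : Fin N → ℕ) (g : WB.RowIxBar N m mt → ℝ)
    (t : Fin N) (r : Fin m) (j : Fin (mt t)) :
    (g ᵥ* WB.Abar N m mt) (Sum.inl ⟨t, (r, j)⟩) =
      g (Sum.inl ⟨t, j⟩) +
        ∑ i : Fin (m - 1), if (r : ℕ) = i + 1 then g (Sum.inr (Sum.inl (t, i))) else 0 := by
  simp only [Matrix.vecMul, dotProduct, Fintype.sum_sum_type, WB.Abar, Matrix.submatrix_apply,
    WB.rowEmbed, WB.A, id, mul_zero, Finset.sum_const_zero, add_zero, mul_ite, mul_one,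
    Fintype.sum_prod_type, Fin.ext_iff (a := r)]
  congr 1
  · rw [Finset.sum_eq_single ⟨t, j⟩]
    · simp
    · rintro ⟨s, k⟩ - hne
      refine if_neg ?_
      rintro ⟨rfl, hk⟩
      exact hne (congrArg _ (Fin.ext hk))
    · simp
  · rw [Finset.sum_eq_single t]
    · simp
    · intro s _ hne
      simp [hne]
    · simp

/-- The action of a row vector on the column of `Ā` indexed by the first weight, whose only
nonzero entry is the one in the last row. -/
lemma WB.vecMul_Abar_inr_zero (N m : ℕ) (mt : Fin N → ℕ) (hm : 0 < m)
    (g : WB.RowIxBar N m mt → ℝ) :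
    (g ᵥ* WB.Abar N m mt) (Sum.inr ⟨0, hm⟩) = g (Sum.inr (Sum.inr 0)) := by
  simp [Matrix.vecMul, dotProduct, Fintype.sum_sum_type, WB.Abar, WB.rowEmbed, WB.A]

/-- The rows of `Ā` are linearly independent. -/
lemma WB.linearIndependent_row_Abar (N m : ℕ) (hm : 0 < m) (mt : Fin N → ℕ)
    (hmt : ∀ t, 0 < mt t) : LinearIndependent ℝ (WB.Abar N m mt).row := by
  rw [← Matrix.vecMul_injective_iff]
  refine (injective_iff_map_eq_zero (WB.Abar N m mt).vecMulLinear).2 ?_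
  intro g hg
  replace hg : g ᵥ* WB.Abar N m mt = 0 := hg
  have hF : ∀ t j, g (Sum.inl ⟨t, j⟩) = 0 := by
    intro t j
    have h := WB.vecMul_Abar_inl N m mt g t ⟨0, hm⟩ j
    simpa [hg] using h.symm
  have hG : ∀ t i, g (Sum.inr (Sum.inl (t, i))) = 0 := by
    intro t i
    have h := WB.vecMul_Abar_inl N m mt g t ⟨i + 1, by omega⟩ ⟨0, hmt t⟩
    simpa [hg, hF, ← Fin.ext_iff] using h.symm
  have hlast : g (Sum.inr (Sum.inr 0)) = 0 := by
    rw [← WB.vecMul_Abar_inr_zero N m mt hm g, hg, Pi.zero_apply]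
  funext x
  rcases x with ⟨t, j⟩ | ⟨t, i⟩ | o
  · exact hF t j
  · exact hG t i
  · rw [Subsingleton.elim o 0]
    exact hlast

/-- The matrix `Ā` obtained from the Wasserstein-barycenter constraint matrix `A` by
deleting the first row of each block `G_t` has full row rank:
`rank Ā = M + N(m-1) + 1` where `M = ∑_t m_t`. -/
theorem barycenter_reduced_constraint_matrix_full_row_rank
    (N m : ℕ) (hN : 0 < N) (hm : 2 ≤ m) (mt : Fin N → ℕ) (hmt : ∀ t, 0 < mt t) :
    (WB.Abar N m mt).rank = (∑ t, mt t) + N * (m - 1) + 1 := by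
  rw [(WB.linearIndependent_row_Abar N m (by omega) mt hmt).rank_matrix]
  simp [add_assoc]
end

section
/- Suppose each weight vector a^{(t)} ∈ ℝ^{m_t} satisfies 1_{m_t}ᵀ a^{(t)} = 1, and let b = (a^{(1)}; …; a^{(N)}; 0_{Nm}; 1) ∈ ℝ^{M+Nm+1} and let b̄ ∈ ℝ^{M+N(m−1)+1} be obtained from b by deleting the entries with indices M+1, M+m+1, …, M+(N−1)m+1. Then for every x ∈ ℝ^{mM+m}, A x = b holds if and only if Ā x = b̄ holds. -/
open Matrix

/-- The right-hand side `b = (a⁽¹⁾; …; a⁽ᴺ⁾; 0_{Nm}; 1)` of the constraint system `A x = b`. -/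
def WB.b (N m : ℕ) (mt : Fin N → ℕ) (a : (t : Fin N) → Fin (mt t) → ℝ) :
    WB.RowIx N m mt → ℝ
  | Sum.inl ⟨t, j⟩ => a t j
  | Sum.inr (Sum.inl _) => 0
  | Sum.inr (Sum.inr _) => 1

/-- The row of `A` belonging to column `j` of `Π⁽ᵗ⁾` computes the sum of that column. -/
theorem WB.A_mulVec_colSum (N m : ℕ) (mt : Fin N → ℕ) (x : WB.ColIx N m mt → ℝ)
    (t : Fin N) (j : Fin (mt t)) :
    (WB.A N m mt *ᵥ x) (Sum.inl ⟨t, j⟩) = ∑ r, x (Sum.inl ⟨t, (r, j)⟩) := by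
  simp only [Matrix.mulVec, dotProduct, Fintype.sum_sum_type, WB.A, Fintype.sum_sigma,
    Fintype.sum_prod_type, zero_mul, Finset.sum_const_zero, add_zero]
  rw [Finset.sum_eq_single t]
  · simp [← Fin.ext_iff]
  · intro t' _ h
    simp [h.symm]
  · simp

/-- The row of `A` belonging to row `i` of `Π⁽ᵗ⁾` computes the sum of that row minus `w i`. -/
theorem WB.A_mulVec_rowSum (N m : ℕ) (mt : Fin N → ℕ) (x : WB.ColIx N m mt → ℝ)
    (t : Fin N) (i : Fin m) :
    (WB.A N m mt *ᵥ x) (Sum.inr (Sum.inl (t, i))) =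
      ∑ j, x (Sum.inl ⟨t, (i, j)⟩) - x (Sum.inr i) := by
  simp only [Matrix.mulVec, dotProduct, Fintype.sum_sum_type, WB.A, Fintype.sum_sigma,
    Fintype.sum_prod_type]
  rw [Finset.sum_eq_single t]
  · rw [Finset.sum_eq_single i]
    · simp [sub_eq_add_neg]
    · intro r _ h
      simp [h]
    · simp
  · intro t' _ h
    simp [h.symm]
  · simp

/-- The last row of `A` computes the total mass of `w`. -/
theorem WB.A_mulVec_last (N m : ℕ) (mt : Fin N → ℕ) (x : WB.ColIx N m mt → ℝ) (o : Fin 1) :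
    (WB.A N m mt *ᵥ x) (Sum.inr (Sum.inr o)) = ∑ r, x (Sum.inr r) := by
  simp [Matrix.mulVec, dotProduct, Fintype.sum_sum_type, WB.A]

/-- The linear dependency among the rows of `A`: in each block, the rows of `G_t` add up to the
sum of the rows of `F_t` minus the last row. -/
theorem WB.sum_A_mulVec (N m : ℕ) (mt : Fin N → ℕ) (x : WB.ColIx N m mt → ℝ) (t : Fin N) :
    ∑ i, (WB.A N m mt *ᵥ x) (Sum.inr (Sum.inl (t, i))) =
      ∑ j, (WB.A N m mt *ᵥ x) (Sum.inl ⟨t, j⟩) -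
        (WB.A N m mt *ᵥ x) (Sum.inr (Sum.inr 0)) := by
  simp only [WB.A_mulVec_colSum, WB.A_mulVec_rowSum, WB.A_mulVec_last, Finset.sum_sub_distrib]
  rw [Finset.sum_comm]

/-- If each weight vector `a⁽ᵗ⁾` sums to `1`, then for every `x`, `A x = b` holds if and
only if `Ā x = b̄` holds, where `Ā` and `b̄` are obtained from `A` and `b` by deleting the
rows/entries with indices `M+1, M+m+1, …, M+(N-1)m+1`. -/
theorem barycenter_reduced_system_equiv
    (N m : ℕ) (hN : 0 < N) (hm : 2 ≤ m) (mt : Fin N → ℕ) (hmt : ∀ t, 0 < mt t)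
    (a : (t : Fin N) → Fin (mt t) → ℝ) (ha : ∀ t, ∑ j, a t j = 1)
    (x : WB.ColIx N m mt → ℝ) :
    WB.A N m mt *ᵥ x = WB.b N m mt a ↔
      WB.Abar N m mt *ᵥ x = (WB.b N m mt a) ∘ (WB.rowEmbed N m mt) := by
  have hbar : WB.Abar N m mt *ᵥ x = (WB.A N m mt *ᵥ x) ∘ WB.rowEmbed N m mt := rfl
  rw [hbar]
  refine ⟨fun h => by rw [h], fun h => ?_⟩
  have hF (t : Fin N) (j : Fin (mt t)) : (WB.A N m mt *ᵥ x) (Sum.inl ⟨t, j⟩) = a t j :=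
    congrFun h (Sum.inl ⟨t, j⟩)
  have hlast (o : Fin 1) : (WB.A N m mt *ᵥ x) (Sum.inr (Sum.inr o)) = 1 :=
    congrFun h (Sum.inr (Sum.inr o))
  obtain ⟨k, rfl⟩ : ∃ k, m = k + 1 := ⟨m - 1, by omega⟩
  have hsucc (t : Fin N) (i : Fin k) :
      (WB.A N (k + 1) mt *ᵥ x) (Sum.inr (Sum.inl (t, i.succ))) = 0 :=
    congrFun h (Sum.inr (Sum.inl (t, i)))
  have hzero (t : Fin N) : (WB.A N (k + 1) mt *ᵥ x) (Sum.inr (Sum.inl (t, 0))) = 0 := by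
    have hsum := WB.sum_A_mulVec N (k + 1) mt x t
    simpa [Fin.sum_univ_succ, hsucc, hF, hlast, ha] using hsum
  ext (⟨t, j⟩ | ⟨t, i⟩ | o)
  · exact hF t j
  · exact Fin.cases (hzero t) (hsucc t) i
  · exact hlast o
end

section
/- Let D be a km × km diagonal real matrix with all diagonal entries positive. Then (G D Gᵀ) 1_{m−1} = (G D Fᵀ) 1_k, i.e. the row sums of G D Gᵀ coincide with the row sums of G D Fᵀ. -/
open Matrix Kronecker

/-- The all-ones column vector `1_n` as an `n × 1` matrix. -/
def onesCol (n : ℕ) : Matrix (Fin n) (Fin 1) ℝ := fun _ _ => 1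

/-- The `(m-1) × m` matrix `[0_{(m-1)×1} | I_{m-1}]` whose first column is zero and whose
remaining columns form the identity. -/
def padId (m : ℕ) : Matrix (Fin (m - 1)) (Fin m) ℝ :=
  fun r j => if (j : ℕ) = (r : ℕ) + 1 then 1 else 0

/-- `F = I_k ⊗ 1_mᵀ ∈ ℝ^{k × km}` (the row index `Fin k × Fin 1` of the Kronecker
product is identified with `Fin k`). -/
def Fmat (k m : ℕ) : Matrix (Fin k) (Fin k × Fin m) ℝ :=
  Matrix.reindex (Equiv.prodUnique (Fin k) (Fin 1)) (Equiv.refl _)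
    ((1 : Matrix (Fin k) (Fin k) ℝ) ⊗ₖ (onesCol m)ᵀ)

/-- `G = 1_kᵀ ⊗ [0_{(m-1)×1} | I_{m-1}] ∈ ℝ^{(m-1) × km}` (the row index
`Fin 1 × Fin (m-1)` of the Kronecker product is identified with `Fin (m-1)`). -/
def Gmat (k m : ℕ) : Matrix (Fin (m - 1)) (Fin k × Fin m) ℝ :=
  Matrix.reindex (Equiv.uniqueProd (Fin (m - 1)) (Fin 1)) (Equiv.refl _)
    ((onesCol k)ᵀ ⊗ₖ padId m)

theorem Gmat_apply (k m : ℕ) (r : Fin (m - 1)) (p : Fin k × Fin m) :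
    Gmat k m r p = if (p.2 : ℕ) = (r : ℕ) + 1 then 1 else 0 := by
  simp [Gmat, onesCol, padId, Matrix.kroneckerMap_apply]

theorem Fmat_apply (k m : ℕ) (i : Fin k) (p : Fin k × Fin m) :
    Fmat k m i p = if i = p.1 then 1 else 0 := by
  simp [Fmat, onesCol, Matrix.kroneckerMap_apply, Matrix.one_apply]

theorem Fmat_transpose_mulVec_one (k m : ℕ) (p : Fin k × Fin m) :
    ((Fmat k m)ᵀ *ᵥ fun _ => (1 : ℝ)) p = 1 := by
  simp [Matrix.mulVec, dotProduct, Fmat_apply]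

/-- The column sums of `G` are `1` away from the zero columns. -/
theorem Gmat_transpose_mulVec_one (k m : ℕ) (p : Fin k × Fin m) (r : Fin (m - 1))
    (h : (p.2 : ℕ) = (r : ℕ) + 1) :
    ((Gmat k m)ᵀ *ᵥ fun _ => (1 : ℝ)) p = 1 := by
  simp [Matrix.mulVec, dotProduct, Gmat_apply, h, Fin.val_inj]

/-- For any `km × km` diagonal matrix `D` with strictly positive diagonal entries,
`(G D Gᵀ) 1_{m-1} = (G D Fᵀ) 1_k`: the row sums of `G D Gᵀ` coincide with the row sums
of `G D Fᵀ`. -/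
theorem GDGt_rowsums_eq_GDFt_rowsums (k m : ℕ) (hk : 0 < k) (hm : 2 ≤ m)
    (d : Fin k × Fin m → ℝ) (hd : ∀ i, 0 < d i) :
    (Gmat k m * Matrix.diagonal d * (Gmat k m)ᵀ) *ᵥ (fun _ => (1 : ℝ)) =
      (Gmat k m * Matrix.diagonal d * (Fmat k m)ᵀ) *ᵥ (fun _ => (1 : ℝ)) := by
  simp only [← Matrix.mulVec_mulVec]
  ext r
  change ∑ p, Gmat k m r p * (diagonal d *ᵥ (Gmat k m)ᵀ *ᵥ fun _ => (1 : ℝ)) p =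
    ∑ p, Gmat k m r p * (diagonal d *ᵥ (Fmat k m)ᵀ *ᵥ fun _ => (1 : ℝ)) p
  refine Finset.sum_congr rfl fun p _ => ?_
  rw [Matrix.mulVec_diagonal, Matrix.mulVec_diagonal, Gmat_apply]
  split_ifs with h
  · rw [Gmat_transpose_mulVec_one k m p r h, Fmat_transpose_mulVec_one]
  · simp
end
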